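/- Elaboration shift lemma: let D be a program formula, t a term, x a variable, and K a clause. If K ∈ elab(D[t/x]) then there exists a clause ∀x.K' ∈ elab(∀x.D) such that K'[t/x] = K. -/

import Mathlib

set_option maxHeartbeats 1000000

/-! ## Syntax of UCTT / HOHH -/

/-- Simple types of Church's theory: individuals, propositions, arrow types. -/
inductive Ty : Type
  | iota : Ty
  | o : Ty
  | arr : Ty → Ty → Ty
  deriving DecidableEq

/-- Free (logic) variables: carry an identifier, a level and a type. -/
structure Vr : Type where
  name : ℕ
  lvl : ℕ
  ty : Ty
  deriving DecidableEq

/-- Constants: carry an identifier, a level and a type. -/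
structure Cs : Type where
  name : ℕ
  lvl : ℕ
  ty : Ty
  deriving DecidableEq

/-- Simply typed λ-terms in (principal) normal form, with formulas (terms of
type `o`) represented by dedicated constructors for the logical constants
`⊤, ⊥, ∧, ∨, ⊃, Π (∀), Σ (∃)` in applied position.  Bound variables (`bvar`)
and free (logic) variables (`fvar`) are disjoint. -/
inductive Tm : Type
  | bvar : ℕ → Ty → Tm
  | fvar : Vr → Tm
  | cst : Cs → Tm
  | app : Tm → Tm → Tm
  | lam : ℕ → Ty → Tm → Tm
  | top : Tm
  | bot : Tm
  | conj : Tm → Tm → Tm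
  | disj : Tm → Tm → Tm
  | impl : Tm → Tm → Tm
  | all : ℕ → Ty → Tm → Tm
  | ex : ℕ → Ty → Tm → Tm
  deriving DecidableEq

namespace Tm

/-- Applying a map on free variables to a term.  Since bound and free
variables are disjoint, no capture can occur. -/
def subst (f : Vr → Tm) : Tm → Tm
  | bvar n a => bvar n a
  | fvar v => f v
  | cst c => cst c
  | app t u => app (subst f t) (subst f u)
  | lam n a t => lam n a (subst f t)
  | top => top
  | bot => bot
  | conj t u => conj (subst f t) (subst f u)
  | disj t u => disj (subst f t) (subst f u)
  | impl t u => impl (subst f t) (subst f u)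
  | all n a t => all n a (subst f t)
  | ex n a t => ex n a (subst f t)

/-- Instantiation `t[s/x]` of the bound variable `(x, a)` by the term `s`. -/
def inst (x : ℕ) (a : Ty) (s : Tm) : Tm → Tm
  | bvar n b => if n = x ∧ b = a then s else bvar n b
  | fvar v => fvar v
  | cst c => cst c
  | app t u => app (inst x a s t) (inst x a s u)
  | lam n b t => if n = x ∧ b = a then lam n b t else lam n b (inst x a s t)
  | top => top
  | bot => bot
  | conj t u => conj (inst x a s t) (inst x a s u)
  | disj t u => disj (inst x a s t) (inst x a s u)
  | impl t u => impl (inst x a s t) (inst x a s u)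
  | all n b t => if n = x ∧ b = a then all n b t else all n b (inst x a s t)
  | ex n b t => if n = x ∧ b = a then ex n b t else ex n b (inst x a s t)

/-- The level of a term: the maximum label of the constants and free
variables occurring in it. -/
def lvl : Tm → ℕ
  | bvar _ _ => 0
  | fvar v => v.lvl
  | cst c => c.lvl
  | app t u => max (lvl t) (lvl u)
  | lam _ _ t => lvl t
  | top => 0
  | bot => 0
  | conj t u => max (lvl t) (lvl u)
  | disj t u => max (lvl t) (lvl u)
  | impl t u => max (lvl t) (lvl u)
  | all _ _ t => lvl t
  | ex _ _ t => lvl t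

/-- The free variables of a term. -/
def fvars : Tm → Finset Vr
  | bvar _ _ => ∅
  | fvar v => {v}
  | cst _ => ∅
  | app t u => fvars t ∪ fvars u
  | lam _ _ t => fvars t
  | top => ∅
  | bot => ∅
  | conj t u => fvars t ∪ fvars u
  | disj t u => fvars t ∪ fvars u
  | impl t u => fvars t ∪ fvars u
  | all _ _ t => fvars t
  | ex _ _ t => fvars t

/-- The constants occurring in a term. -/
def csts : Tm → Finset Cs
  | bvar _ _ => ∅
  | fvar _ => ∅
  | cst c => {c}
  | app t u => csts t ∪ csts u
  | lam _ _ t => csts t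
  | top => ∅
  | bot => ∅
  | conj t u => csts t ∪ csts u
  | disj t u => csts t ∪ csts u
  | impl t u => csts t ∪ csts u
  | all _ _ t => csts t
  | ex _ _ t => csts t

/-- The canonical type of a term (meaningful on well-typed terms). -/
def tyOf : Tm → Ty
  | bvar _ a => a
  | fvar v => v.ty
  | cst c => c.ty
  | app t _ =>
      match tyOf t with
      | Ty.arr _ b => b
      | b => b
  | lam _ a t => Ty.arr a (tyOf t)
  | _ => Ty.o

/-- Well-typedness of a term. -/
def wt : Tm → Prop
  | bvar _ _ => True
  | fvar _ => True
  | cst _ => True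
  | app t u => wt t ∧ wt u ∧ ∃ b, tyOf t = Ty.arr (tyOf u) b
  | lam _ _ t => wt t
  | top => True
  | bot => True
  | conj t u => wt t ∧ wt u ∧ tyOf t = Ty.o ∧ tyOf u = Ty.o
  | disj t u => wt t ∧ wt u ∧ tyOf t = Ty.o ∧ tyOf u = Ty.o
  | impl t u => wt t ∧ wt u ∧ tyOf t = Ty.o ∧ tyOf u = Ty.o
  | all _ _ t => wt t ∧ tyOf t = Ty.o
  | ex _ _ t => wt t ∧ tyOf t = Ty.o

/-- Positive terms: terms not containing `⊥`, `⊃` or `∀`. -/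
def pos : Tm → Prop
  | bot => False
  | impl _ _ => False
  | all _ _ _ => False
  | app t u => pos t ∧ pos u
  | lam _ _ t => pos t
  | conj t u => pos t ∧ pos u
  | disj t u => pos t ∧ pos u
  | ex _ _ t => pos t
  | _ => True

/-- The head of an application spine. -/
def headTm : Tm → Tm
  | app t _ => headTm t
  | t => t

/-- Atomic formulas: terms (of type `o`) whose outermost constructor is not
a logical constant. -/
def isAtom : Tm → Prop
  | fvar _ => True
  | cst _ => True
  | app _ _ => True
  | _ => False

/-- An atomic formula is rigid when its head symbol is a constant. -/
def rigid (t : Tm) : Prop := ∃ c : Cs, t.headTm = cst c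

mutual
  /-- HOHH program formulas: `D ::= A_r | G ⊃ A_r | D ∧ D | ∀x.D`. -/
  inductive isProg : Tm → Prop
    | atom {t : Tm} : t.isAtom → t.rigid → isProg t
    | imp {g a : Tm} : isGoal g → a.isAtom → a.rigid → isProg (Tm.impl g a)
    | conj {d₁ d₂ : Tm} : isProg d₁ → isProg d₂ → isProg (Tm.conj d₁ d₂)
    | all {n : ℕ} {a : Ty} {d : Tm} : isProg d → isProg (Tm.all n a d)

  /-- HOHH goal formulas:
  `G ::= ⊤ | A | G ∨ G | G ∧ G | ∃x.G | D ⊃ G | ∀x.G`. -/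
  inductive isGoal : Tm → Prop
    | top : isGoal Tm.top
    | atom {t : Tm} : t.isAtom → isGoal t
    | conj {g₁ g₂ : Tm} : isGoal g₁ → isGoal g₂ → isGoal (Tm.conj g₁ g₂)
    | disj {g₁ g₂ : Tm} : isGoal g₁ → isGoal g₂ → isGoal (Tm.disj g₁ g₂)
    | ex {n : ℕ} {a : Ty} {g : Tm} : isGoal g → isGoal (Tm.ex n a g)
    | imp {d g : Tm} : isProg d → isGoal g → isGoal (Tm.impl d g)
    | all {n : ℕ} {a : Ty} {g : Tm} : isGoal g → isGoal (Tm.all n a g)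
end

/-- The elaboration of a program formula into its set of clauses. -/
def elabD : Tm → Set Tm
  | Tm.conj d₁ d₂ => elabD d₁ ∪ elabD d₂
  | Tm.all n a d => Tm.all n a '' elabD d
  | d => {d}

/-- Iterated universal quantification `∀x₁ … ∀xₙ. t`. -/
def alls : List (ℕ × Ty) → Tm → Tm
  | [], t => t
  | x :: xs, t => Tm.all x.1 x.2 (alls xs t)

/-- Simultaneous instantiation of a list of bound variables by a list of
terms (outermost binder first). -/
def instL : List (ℕ × Ty) → List Tm → Tm → Tm
  | x :: xs, s :: ss, t => instL xs ss (inst x.1 x.2 s t)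
  | _, _, t => t

end Tm

/-- The elaboration of a program (set of program formulas). -/
def elabProg (P : Finset Tm) : Set Tm := ⋃ D ∈ P, Tm.elabD D

/-! ## Substitutions -/

/-- Substitutions: finitely supported maps from free variables to terms. -/
structure Subst : Type where
  f : Vr → Tm
  fin : Set.Finite {v : Vr | f v ≠ Tm.fvar v}

namespace Subst

/-- The domain (support) of a substitution. -/
def dom (θ : Subst) : Set Vr := {v : Vr | θ.f v ≠ Tm.fvar v}

/-- The identity substitution. -/
protected def id : Subst :=
  ⟨fun v => Tm.fvar v, by
    have : {v : Vr | Tm.fvar v ≠ Tm.fvar v} = ∅ := by ext v; simp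
    rw [this]; exact Set.finite_empty⟩

/-- Composition of substitutions, in diagrammatic order. -/
def comp (σ τ : Subst) : Subst :=
  ⟨fun v => (σ.f v).subst τ.f, by
    apply Set.Finite.subset (σ.fin.union τ.fin)
    intro v hv
    simp only [Set.mem_setOf_eq] at hv
    by_contra h
    simp only [Set.mem_union, Set.mem_setOf_eq, not_or, not_not] at h
    apply hv
    rw [h.1]
    simp [Tm.subst, h.2]⟩

/-- Restriction of a substitution to a finite set of variables. -/
def restrict (σ : Subst) (S : Finset Vr) : Subst :=
  ⟨fun v => if v ∈ S then σ.f v else Tm.fvar v, by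
    apply Set.Finite.subset σ.fin
    intro v hv
    simp only [Set.mem_setOf_eq] at hv ⊢
    by_cases h : v ∈ S
    · simpa [h] using hv
    · simp [h] at hv⟩

/-- The substitution replacing the single variable `x` by the term `t`. -/
def single (x : Vr) (t : Tm) : Subst :=
  ⟨fun v => if v = x then t else Tm.fvar v, by
    apply Set.Finite.subset (Set.finite_singleton x)
    intro v hv
    simp only [Set.mem_setOf_eq] at hv
    by_cases h : v = x
    · simp [h]
    · simp [h] at hv⟩

/-- Legal substitutions: the range consists of positive well-typed terms,
types are preserved, and levels are preserved. -/
def legal (θ : Subst) : Prop :=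
  ∀ v : Vr, (θ.f v).pos ∧ (θ.f v).wt ∧ (θ.f v).tyOf = v.ty ∧ (θ.f v).lvl ≤ v.lvl

/-- Safe (idempotent) substitutions: the free variables of the range are
disjoint from the domain. -/
def safe (θ : Subst) : Prop :=
  ∀ v w : Vr, θ.f v ≠ Tm.fvar v → w ∈ (θ.f v).fvars → θ.f w = Tm.fvar w

/-- A substitution has level `≤ i` when every term in its range does. -/
def lvlLe (θ : Subst) (i : ℕ) : Prop :=
  ∀ v ∈ θ.dom, (θ.f v).lvl ≤ i

end Subst

/-- Elaboration commutes with instantiation on program formulas: each clause of `elab(D[s/x])` is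
an instance of a clause of `elab(D)`. -/
theorem Tm.exists_mem_elabD_inst_eq {x : ℕ} {a : Ty} {s D K : Tm} (hD : D.isProg)
    (hK : K ∈ Tm.elabD (Tm.inst x a s D)) : ∃ K' ∈ Tm.elabD D, Tm.inst x a s K' = K := by
  induction D generalizing K with
  | bvar n b => cases hD with | atom h _ => exact h.elim
  | conj d₁ d₂ ih₁ ih₂ =>
    cases hD with
    | atom h _ => exact h.elim
    | conj h₁ h₂ =>
      rcases hK with hK | hK
      · obtain ⟨K', hK', rfl⟩ := ih₁ h₁ hK
        exact ⟨K', Or.inl hK', rfl⟩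
      · obtain ⟨K', hK', rfl⟩ := ih₂ h₂ hK
        exact ⟨K', Or.inr hK', rfl⟩
  | all n b d ih =>
    cases hD with
    | atom h _ => exact h.elim
    | all hd =>
      by_cases hn : n = x ∧ b = a
      · rw [Tm.inst, if_pos hn] at hK
        obtain ⟨L, hL, rfl⟩ := hK
        exact ⟨Tm.all n b L, ⟨L, hL, rfl⟩, by rw [Tm.inst, if_pos hn]⟩
      · rw [Tm.inst, if_neg hn] at hK
        obtain ⟨L, hL, rfl⟩ := hK
        obtain ⟨L', hL', rfl⟩ := ih hd hL
        exact ⟨Tm.all n b L', ⟨L', hL', rfl⟩, by rw [Tm.inst, if_neg hn]⟩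
  | lam => cases hD with | atom h _ => exact h.elim
  | ex => cases hD with | atom h _ => exact h.elim
  | _ => exact ⟨_, rfl, hK.symm⟩

/-- **Elaboration shift lemma.**  Let `D` be a program formula, `t` a term,
`x` a (bound) variable and `K` a clause.  If `K ∈ elab(D[t/x])` then there is
a clause `∀x.K' ∈ elab(∀x.D)` such that `K'[t/x] = K`. -/
theorem elab_shift (D : Tm) (x : ℕ) (a : Ty) (t : Tm) (K : Tm)
    (hD : Tm.isProg D) (hK : K ∈ Tm.elabD (Tm.inst x a t D)) :
    ∃ K' : Tm, Tm.all x a K' ∈ Tm.elabD (Tm.all x a D) ∧ Tm.inst x a t K' = K := by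
  obtain ⟨K', hK', h⟩ := Tm.exists_mem_elabD_inst_eq hD hK
  exact ⟨K', ⟨K', hK', rfl⟩, h⟩
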